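/- arXiv:1811.01270 — 5 statements merged into one kernel-verified Lean document; each statement's English description precedes it below -/
import Mathlib

section
/- Let C be a congestion policy, let 0 ≤ δ < 1 and ε ≥ 0. If a strategy A is δ-redundant and ε-sgreedy, then for every strategy B, U_A(B) ≤ ((1+C(k))/(1−δ))·U_A(A) + (T+1)·ε. -/
open Finset

/-- `A` is a doubly-substochastic `M × T` matrix: boxes `1..M`, rounds `1..T`,
nonnegative entries, every row and every column sums to at most 1. -/
def Substochastic (M T : ℕ) (A : ℕ → ℕ → ℝ) : Prop :=
  (∀ x t, 0 ≤ A x t) ∧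
  (∀ x ∈ Icc 1 M, ∑ t ∈ Icc 1 T, A x t ≤ 1) ∧
  (∀ t ∈ Icc 1 T, ∑ x ∈ Icc 1 M, A x t ≤ 1)

/-- `N̄_A(x,t)`: the probability that `A` does not visit box `x` by (and including) round `t`. -/
def Nbar (A : ℕ → ℕ → ℝ) (x t : ℕ) : ℝ := 1 - ∑ s ∈ Icc 1 t, A x s

/-- `f` is a positive, nonincreasing probability distribution on boxes `1..M`. -/
def BoxDist (M : ℕ) (f : ℕ → ℝ) : Prop :=
  (∀ x ∈ Icc 1 M, 0 < f x) ∧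
  (∀ x, 1 ≤ x → x + 1 ≤ M → f (x + 1) ≤ f x) ∧
  (∑ x ∈ Icc 1 M, f x = 1)

/-- `C` is a congestion policy for `k` players: nonnegative, nonincreasing on `1..k`,
`C 1 = 1`, and `C ℓ < 1` for some `ℓ ≤ k`. -/
def Policy (k : ℕ) (C : ℕ → ℝ) : Prop :=
  (∀ ℓ, 1 ≤ ℓ → ℓ ≤ k → 0 ≤ C ℓ) ∧ (C 1 = 1) ∧
  (∀ ℓ ℓ', 1 ≤ ℓ → ℓ ≤ ℓ' → ℓ' ≤ k → C ℓ' ≤ C ℓ) ∧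
  (∃ ℓ, 1 ≤ ℓ ∧ ℓ ≤ k ∧ C ℓ < 1)

/-- The value of box `x` at round `t` against `k-1` copies of `A`. -/
def val (k : ℕ) (C f : ℕ → ℝ) (A : ℕ → ℕ → ℝ) (x t : ℕ) : ℝ :=
  f x * ∑ ℓ ∈ range k,
    C (ℓ + 1) * ((k - 1).choose ℓ : ℝ) * A x t ^ ℓ * Nbar A x t ^ (k - 1 - ℓ)

/-- The utility of `B` against `k-1` copies of `A`. -/
def util (M T k : ℕ) (C f : ℕ → ℝ) (A B : ℕ → ℕ → ℝ) : ℝ :=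
  ∑ t ∈ Icc 1 T, ∑ x ∈ Icc 1 M, B x t * val k C f A x t

/-- `A` is non-redundant: each column `t ≤ min T M` sums to exactly 1. -/
def NonRedundant (M T : ℕ) (A : ℕ → ℕ → ℝ) : Prop :=
  ∀ t, 1 ≤ t → t ≤ min T M → ∑ x ∈ Icc 1 M, A x t = 1

/-- `A` is self-greedy: for each round `t ≤ T` it is greedy at round `t` with respect to
`k-1` copies of itself. -/
def SGreedy (M T k : ℕ) (C f : ℕ → ℝ) (A : ℕ → ℕ → ℝ) : Prop :=
  ∀ t, 1 ≤ t → t ≤ T → ∀ B, Substochastic M T B →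
    (∀ x s, s < t → B x s = A x s) →
    ∑ x ∈ Icc 1 M, B x t * val k C f A x t ≤ ∑ x ∈ Icc 1 M, A x t * val k C f A x t

/-- `A` is `δ`-redundant: every column `t ≤ min T M` sums to at least `1 - δ`. -/
def DeltaRedundant (M T : ℕ) (δ : ℝ) (A : ℕ → ℕ → ℝ) : Prop :=
  ∀ t, 1 ≤ t → t ≤ min T M → 1 - δ ≤ ∑ x ∈ Icc 1 M, A x t

/-- `A` is `ε`-sgreedy: for every round `t ≤ T` and boxes `x, y`, if `A(x,t) > 0` and
`v_A(y,t) > v_A(x,t) + ε` then `N̄_A(y,t) = 0`. -/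
def EpsSGreedy (M T k : ℕ) (C f : ℕ → ℝ) (ε : ℝ) (A : ℕ → ℕ → ℝ) : Prop :=
  ∀ t, 1 ≤ t → t ≤ T → ∀ x ∈ Icc 1 M, ∀ y ∈ Icc 1 M,
    0 < A x t → val k C f A x t + ε < val k C f A y t → Nbar A y t = 0

lemma Nbar_succ (A : ℕ → ℕ → ℝ) (x t : ℕ) : A x (t + 1) + Nbar A x (t + 1) = Nbar A x t := by
  unfold Nbar
  rw [Finset.sum_Icc_succ_top (by omega)]
  ring

lemma Nbar_antitone {A : ℕ → ℕ → ℝ} (hA : ∀ x t, 0 ≤ A x t) (x : ℕ) : Antitone (Nbar A x) :=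
  antitone_nat_of_succ_le fun t => by linarith [Nbar_succ A x t, hA x (t + 1)]

lemma Substochastic.Nbar_nonneg {M T : ℕ} {A : ℕ → ℕ → ℝ} (hA : Substochastic M T A) {x t : ℕ}
    (hx : x ∈ Icc 1 M) (ht : t ≤ T) : 0 ≤ Nbar A x t := by
  refine le_trans ?_ (Nbar_antitone hA.1 x ht)
  unfold Nbar
  linarith [hA.2.1 x hx]

lemma Policy.le_one {k : ℕ} {C : ℕ → ℝ} (hC : Policy k C) {l : ℕ} (h1 : 1 ≤ l) (h2 : l ≤ k) :
    C l ≤ 1 :=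
  hC.2.1 ▸ hC.2.2.1 1 l le_rfl h1 h2

lemma val_term_nonneg {k : ℕ} {C : ℕ → ℝ} (hC : Policy k C) {A : ℕ → ℕ → ℝ} {x t : ℕ}
    (ha : 0 ≤ A x t) (hN : 0 ≤ Nbar A x t) {l : ℕ} (hl : l ∈ range k) :
    0 ≤ C (l + 1) * ((k - 1).choose l : ℝ) * A x t ^ l * Nbar A x t ^ (k - 1 - l) := by
  have := hC.1 (l + 1) (by omega) (by simpa using hl)
  positivity

lemma val_nonneg {k : ℕ} {C f : ℕ → ℝ} (hC : Policy k C) {A : ℕ → ℕ → ℝ} {x t : ℕ}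
    (hf : 0 ≤ f x) (ha : 0 ≤ A x t) (hN : 0 ≤ Nbar A x t) : 0 ≤ val k C f A x t :=
  mul_nonneg hf (sum_nonneg fun _ hl => val_term_nonneg hC ha hN hl)

lemma mul_Nbar_pow_le_val {k : ℕ} (hk : 1 ≤ k) {C f : ℕ → ℝ} (hC : Policy k C)
    {A : ℕ → ℕ → ℝ} {x t : ℕ} (hf : 0 ≤ f x) (ha : 0 ≤ A x t) (hN : 0 ≤ Nbar A x t) :
    f x * Nbar A x t ^ (k - 1) ≤ val k C f A x t := by
  refine mul_le_mul_of_nonneg_left ?_ hf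
  have := single_le_sum (fun _ hl => val_term_nonneg hC ha hN hl) (mem_range.2 hk)
  simpa [hC.2.1] using this

lemma val_le_mul_add_pow {k : ℕ} (hk : 1 ≤ k) {C f : ℕ → ℝ} (hC : Policy k C)
    {A : ℕ → ℕ → ℝ} {x t : ℕ} (hf : 0 ≤ f x) (ha : 0 ≤ A x t) (hN : 0 ≤ Nbar A x t) :
    val k C f A x t ≤ f x * (A x t + Nbar A x t) ^ (k - 1) := by
  refine mul_le_mul_of_nonneg_left ?_ hf
  rw [add_pow, Nat.sub_add_cancel hk]
  refine sum_le_sum fun l hl => ?_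
  have h1 := hC.le_one (l := l + 1) (by omega) (by simpa using hl)
  have h2 : 0 ≤ ((k - 1).choose l : ℝ) * A x t ^ l * Nbar A x t ^ (k - 1 - l) := by positivity
  calc _ = C (l + 1) * (((k - 1).choose l : ℝ) * A x t ^ l * Nbar A x t ^ (k - 1 - l)) := by ring
    _ ≤ 1 * (((k - 1).choose l : ℝ) * A x t ^ l * Nbar A x t ^ (k - 1 - l)) := by gcongr
    _ = _ := by ring

lemma val_of_Nbar_eq_zero {k : ℕ} (hk : 1 ≤ k) (C f : ℕ → ℝ) {A : ℕ → ℕ → ℝ} {x t : ℕ}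
    (hN : Nbar A x t = 0) : val k C f A x t = f x * (C k * A x t ^ (k - 1)) := by
  unfold _root_.val
  rw [hN, sum_eq_single (k - 1)]
  · simp [Nat.sub_add_cancel hk]
  · intro l hl hne
    rw [zero_pow (by have := mem_range.1 hl; omega), mul_zero]
  · intro h
    exact absurd (mem_range.2 (by omega)) h

/-- The value of a box never increases over the rounds. -/
lemma val_le_val {M T k : ℕ} (hk : 1 ≤ k) {C f : ℕ → ℝ} (hC : Policy k C)
    {A : ℕ → ℕ → ℝ} (hA : Substochastic M T A) {x : ℕ} (hx : x ∈ Icc 1 M) (hf : 0 ≤ f x)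
    {s t : ℕ} (hst : s < t) (ht : t ≤ T) : val k C f A x t ≤ val k C f A x s := by
  obtain ⟨u, rfl⟩ : ∃ u, t = u + 1 := ⟨t - 1, by omega⟩
  have hN := hA.Nbar_nonneg hx ht
  have hNu := hA.Nbar_nonneg hx (t := u) (by omega)
  calc val k C f A x (u + 1)
      ≤ f x * (A x (u + 1) + Nbar A x (u + 1)) ^ (k - 1) :=
        val_le_mul_add_pow hk hC hf (hA.1 _ _) hN
    _ = f x * Nbar A x u ^ (k - 1) := by rw [Nbar_succ]
    _ ≤ f x * Nbar A x s ^ (k - 1) := by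
        gcongr
        exact Nbar_antitone hA.1 x (by omega)
    _ ≤ val k C f A x s :=
        mul_Nbar_pow_le_val hk hC hf (hA.1 _ _) (hA.Nbar_nonneg hx (by omega))

/-- Weak duality for the assignment problem. -/
lemma util_le_of_dual {M T k : ℕ} {C f : ℕ → ℝ} {A B : ℕ → ℕ → ℝ} (hB : Substochastic M T B)
    {α γ : ℕ → ℝ} (hα : ∀ x ∈ Icc 1 M, 0 ≤ α x) (hγ : ∀ t ∈ Icc 1 T, 0 ≤ γ t)
    (h : ∀ x ∈ Icc 1 M, ∀ t ∈ Icc 1 T, val k C f A x t ≤ α x + γ t) :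
    util M T k C f A B ≤ ∑ x ∈ Icc 1 M, α x + ∑ t ∈ Icc 1 T, γ t := by
  calc util M T k C f A B
      ≤ ∑ t ∈ Icc 1 T, ∑ x ∈ Icc 1 M, B x t * (α x + γ t) :=
        sum_le_sum fun t ht => sum_le_sum fun x hx =>
          mul_le_mul_of_nonneg_left (h x hx t ht) (hB.1 x t)
    _ = ∑ x ∈ Icc 1 M, (∑ t ∈ Icc 1 T, B x t) * α x
          + ∑ t ∈ Icc 1 T, (∑ x ∈ Icc 1 M, B x t) * γ t := by
        simp only [mul_add, sum_add_distrib, sum_mul]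
        rw [sum_comm]
    _ ≤ _ := add_le_add
        (sum_le_sum fun x hx => mul_le_of_le_one_left (hα x hx) (hB.2.1 x hx))
        (sum_le_sum fun t ht => mul_le_of_le_one_left (hγ t ht) (hB.2.2 t ht))

/-- If a box is exhausted at round `t`, its utility share dominates its value at round `t`,
discounted by the mass assigned at that round. -/
lemma one_sub_mul_val_le {M T k : ℕ} (hk : 1 ≤ k) {C f : ℕ → ℝ} (hC : Policy k C)
    {A : ℕ → ℕ → ℝ} (hA : Substochastic M T A) {x : ℕ} (hx : x ∈ Icc 1 M) (hf : 0 ≤ f x)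
    {t : ℕ} (ht : t ∈ Icc 1 T) (hN : Nbar A x t = 0) :
    (1 - A x t) * val k C f A x t ≤ C k * ∑ s ∈ Icc 1 T, A x s * val k C f A x s := by
  obtain ⟨ht1, htT⟩ := mem_Icc.1 ht
  obtain ⟨u, rfl⟩ : ∃ u, t = u + 1 := ⟨t - 1, by omega⟩
  have hu : A x (u + 1) = Nbar A x u := by rw [← Nbar_succ, hN, add_zero]
  have hsum : ∑ s ∈ Icc 1 u, A x s = 1 - A x (u + 1) := by
    rw [hu]
    unfold Nbar
    ring
  have hterm : ∀ s ∈ Icc 1 u, A x s * (f x * A x (u + 1) ^ (k - 1)) ≤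
      A x s * val k C f A x s := fun s hs => by
    have hs := mem_Icc.1 hs
    refine mul_le_mul_of_nonneg_left (le_trans ?_ (mul_Nbar_pow_le_val hk hC hf (hA.1 x s)
      (hA.Nbar_nonneg hx (by omega)))) (hA.1 x s)
    have := Nbar_antitone hA.1 x hs.2
    have := hA.1 x (u + 1)
    rw [hu] at this ⊢
    gcongr
  have hle : ∑ s ∈ Icc 1 u, A x s * val k C f A x s ≤
      ∑ s ∈ Icc 1 T, A x s * val k C f A x s :=
    sum_le_sum_of_subset_of_nonneg (Icc_subset_Icc_right (by omega)) fun s hs _ =>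
      mul_nonneg (hA.1 x s) (val_nonneg hC hf (hA.1 x s) (hA.Nbar_nonneg hx (mem_Icc.1 hs).2))
  rw [val_of_Nbar_eq_zero hk C f hN]
  calc (1 - A x (u + 1)) * (f x * (C k * A x (u + 1) ^ (k - 1)))
      = C k * ∑ s ∈ Icc 1 u, A x s * (f x * A x (u + 1) ^ (k - 1)) := by
        rw [← sum_mul, hsum]
        ring
    _ ≤ C k * ∑ s ∈ Icc 1 T, A x s * val k C f A x s :=
        mul_le_mul_of_nonneg_left ((sum_le_sum hterm).trans hle) (hC.1 k hk le_rfl)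

/-- A box whose value beats `m t + ε` only when exhausted admits a small dual price. -/
lemma exists_row_price {M T τ k : ℕ} (hk : 2 ≤ k) (hτ : τ ≤ T) {C f : ℕ → ℝ} (hC : Policy k C)
    {A : ℕ → ℕ → ℝ} (hA : Substochastic M T A) {x : ℕ} (hx : x ∈ Icc 1 M) (hf : 0 ≤ f x)
    {ε : ℝ} (hε : 0 ≤ ε) {m : ℕ → ℝ} (hm0 : ∀ t ∈ Icc 1 τ, 0 ≤ m t)
    (hm : ∀ t ∈ Icc 1 τ, 0 < A x t → m t ≤ val k C f A x t)
    (hN : ∀ t ∈ Icc 1 τ, m t + ε < val k C f A x t → Nbar A x t = 0) :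
    ∃ α : ℝ, 0 ≤ α ∧ (∀ t ∈ Icc 1 τ, val k C f A x t ≤ α + (m t + ε)) ∧
      α ≤ C k * ∑ s ∈ Icc 1 T, A x s * val k C f A x s
        + ∑ t ∈ Icc 1 τ, A x t * (val k C f A x t - m t) := by
  have hCk := hC.1 k (by omega) le_rfl
  have hrow : 0 ≤ C k * ∑ s ∈ Icc 1 T, A x s * val k C f A x s :=
    mul_nonneg hCk (sum_nonneg fun s hs =>
      mul_nonneg (hA.1 x s) (val_nonneg hC hf (hA.1 x s) (hA.Nbar_nonneg hx (mem_Icc.1 hs).2)))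
  have hterm : ∀ t ∈ Icc 1 τ, 0 ≤ A x t * (val k C f A x t - m t) := fun t ht => by
    rcases (hA.1 x t).eq_or_lt with h | h
    · simp [← h]
    · exact mul_nonneg h.le (sub_nonneg.2 (hm t ht h))
  by_cases hex : ∃ t ∈ Icc 1 τ, m t + ε < val k C f A x t
  · obtain ⟨t, ht, hlt⟩ := hex
    have pos : ∀ s ∈ Icc 1 τ, m s + ε < val k C f A x s → 0 < A x s := fun s hs h => by
      refine (hA.1 x s).lt_of_ne fun h0 => ?_
      rw [val_of_Nbar_eq_zero (by omega) C f (hN s hs h), ← h0, zero_pow (by omega)] at h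
      have := hm0 s hs
      simp only [mul_zero] at h
      linarith
    have no_later : ∀ s ∈ Icc 1 τ, ∀ r ∈ Icc 1 τ, m s + ε < val k C f A x s →
        m r + ε < val k C f A x r → ¬ s < r := fun s hs r hr h h' hsr => by
      obtain ⟨u, rfl⟩ : ∃ u, r = u + 1 := ⟨r - 1, by omega⟩
      have h1 := pos _ hr h'
      have h2 := Nbar_succ A x u
      have h3 : Nbar A x u ≤ Nbar A x s := Nbar_antitone hA.1 x (by omega)
      rw [hN _ hr h'] at h2
      rw [hN _ hs h] at h3
      linarith
    refine ⟨val k C f A x t - (m t + ε), by linarith, fun s hs => ?_, ?_⟩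
    · by_contra! hcon
      have hs' : m s + ε < val k C f A x s := by linarith
      have hst : s = t :=
        le_antisymm (not_lt.1 (no_later t ht s hs hlt hs')) (not_lt.1 (no_later s hs t ht hs' hlt))
      subst hst
      linarith
    · have htT : t ∈ Icc 1 T := Icc_subset_Icc_right hτ ht
      have h1 := one_sub_mul_val_le (by omega) hC hA hx hf htT (hN t ht hlt)
      have h2 := single_le_sum hterm ht
      have ha1 : A x t ≤ 1 := (single_le_sum (fun s _ => hA.1 x s) htT).trans (hA.2.1 x hx)
      have h3 := mul_nonneg (sub_nonneg.2 ha1) (hm0 t ht)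
      linarith
  · push Not at hex
    exact ⟨0, le_rfl, fun t ht => by linarith [hex t ht], add_nonneg hrow (sum_nonneg hterm)⟩

/-- Duality with prices given only on the first `min T M` rounds, for values that do not
increase afterwards. -/
lemma util_le_of_dual_min {M T k : ℕ} (hM : 1 ≤ M) (hk : 1 ≤ k) {C f : ℕ → ℝ}
    (hC : Policy k C) (hf : ∀ x ∈ Icc 1 M, 0 ≤ f x) {A B : ℕ → ℕ → ℝ}
    (hA : Substochastic M T A) (hB : Substochastic M T B) {α β : ℕ → ℝ}
    (hα : ∀ x ∈ Icc 1 M, 0 ≤ α x) (hβ : ∀ t ∈ Icc 1 (min T M), 0 ≤ β t)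
    (h : ∀ x ∈ Icc 1 M, ∀ t ∈ Icc 1 (min T M), val k C f A x t ≤ α x + β t) :
    util M T k C f A B ≤ ∑ x ∈ Icc 1 M, α x + ∑ t ∈ Icc 1 (min T M), β t := by
  rcases le_total T M with hTM | hTM
  · rw [min_eq_left hTM] at *
    exact util_le_of_dual hB hα hβ h
  rw [min_eq_right hTM] at *
  obtain ⟨s, hs, hmin⟩ := exists_min_image (Icc 1 M) β ⟨1, mem_Icc.2 ⟨le_rfl, hM⟩⟩
  have key := util_le_of_dual hB (α := fun x => α x + β s)
    (γ := fun t => if t ∈ Icc 1 M then β t - β s else 0)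
    (fun x hx => add_nonneg (hα x hx) (hβ s hs))
    (fun t _ => by
      split_ifs with ht
      · exact sub_nonneg.2 (hmin t ht)
      · exact le_rfl)
    (fun x hx t ht => by
      split_ifs with htM
      · linarith [h x hx t htM]
      · have hs' := mem_Icc.1 hs
        have ht' := mem_Icc.1 ht
        have : M < t := by
          by_contra! hle
          exact htM (mem_Icc.2 ⟨ht'.1, hle⟩)
        linarith [h x hx s hs, val_le_val hk hC hA hx (hf x hx) (s := s) (by omega) ht'.2])
  refine key.trans (le_of_eq ?_)
  rw [← sum_filter, filter_mem_eq_inter, inter_eq_right.2 (Icc_subset_Icc_right hTM)]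
  simp [sum_add_distrib]

/-- a `δ`-redundant `ε`-sgreedy strategy is an approximate equilibrium:
for every strategy `B`, `U_A(B) ≤ ((1 + C k)/(1 - δ))·U_A(A) + (T+1)·ε`. -/
theorem approx_sgreedy_approx_equilibrium
    (M T k : ℕ) (hM : 1 ≤ M) (hT : 1 ≤ T) (hk : 2 ≤ k)
    (C f : ℕ → ℝ) (hC : Policy k C) (hf : BoxDist M f)
    (δ ε : ℝ) (hδ0 : 0 ≤ δ) (hδ1 : δ < 1) (hε : 0 ≤ ε)
    (A : ℕ → ℕ → ℝ) (hA : Substochastic M T A)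
    (hDR : DeltaRedundant M T δ A) (hSG : EpsSGreedy M T k C f ε A) :
    ∀ B, Substochastic M T B →
      util M T k C f A B ≤ (1 + C k) / (1 - δ) * util M T k C f A A + ((T : ℝ) + 1) * ε := by
  intro B hB
  have hf0 : ∀ x ∈ Icc 1 M, 0 ≤ f x := fun x hx => (hf.1 x hx).le
  have hv : ∀ x ∈ Icc 1 M, ∀ t ∈ Icc 1 T, 0 ≤ val k C f A x t := fun x hx t ht =>
    val_nonneg hC (hf0 x hx) (hA.1 x t) (hA.Nbar_nonneg hx (mem_Icc.1 ht).2)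
  have hsub : Icc 1 (min T M) ⊆ Icc 1 T := Icc_subset_Icc_right (min_le_left T M)
  have hmin : ∀ t, ∃ m : ℝ, t ∈ Icc 1 (min T M) → 0 ≤ m ∧
      (∀ x ∈ Icc 1 M, 0 < A x t → m ≤ val k C f A x t) ∧
      (∀ y ∈ Icc 1 M, m + ε < val k C f A y t → Nbar A y t = 0) := fun t => by
    by_cases ht : t ∈ Icc 1 (min T M)
    swap
    · exact ⟨0, fun h => absurd h ht⟩
    have ht' := mem_Icc.1 (hsub ht)
    have hpos : 0 < ∑ x ∈ Icc 1 M, A x t := by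
      have := hDR t (mem_Icc.1 ht).1 (mem_Icc.1 ht).2
      linarith
    obtain ⟨x₀, hx₀, hx₀A⟩ := (sum_pos_iff_of_nonneg fun x _ => hA.1 x t).1 hpos
    obtain ⟨x, hx, hxmin⟩ := exists_min_image ((Icc 1 M).filter fun x => 0 < A x t)
      (fun x => val k C f A x t) ⟨x₀, mem_filter.2 ⟨hx₀, hx₀A⟩⟩
    obtain ⟨hxM, hxA⟩ := mem_filter.1 hx
    exact ⟨val k C f A x t, fun _ => ⟨hv x hxM t (hsub ht),
      fun y hy hyA => hxmin y (mem_filter.2 ⟨hy, hyA⟩),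
      fun y hy => hSG t ht'.1 ht'.2 x hxM y hy hxA⟩⟩
  choose m hm using hmin
  have hprice : ∀ x, ∃ α : ℝ, x ∈ Icc 1 M → 0 ≤ α ∧
      (∀ t ∈ Icc 1 (min T M), val k C f A x t ≤ α + (m t + ε)) ∧
      α ≤ C k * ∑ s ∈ Icc 1 T, A x s * val k C f A x s
        + ∑ t ∈ Icc 1 (min T M), A x t * (val k C f A x t - m t) := fun x => by
    by_cases hx : x ∈ Icc 1 M
    · obtain ⟨α, hα⟩ := exists_row_price hk (min_le_left T M) hC hA hx (hf0 x hx) hε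
        (fun t ht => (hm t ht).1) (fun t ht => (hm t ht).2.1 x hx) (fun t ht => (hm t ht).2.2 x hx)
      exact ⟨α, fun _ => hα⟩
    · exact ⟨0, fun h => absurd h hx⟩
  choose α hα using hprice
  have hdual := util_le_of_dual_min hM (by omega) hC hf0 hA hB (fun x hx => (hα x hx).1)
    (fun t ht => add_nonneg (hm t ht).1 hε) (fun x hx => (hα x hx).2.1)
  have hcol : ∀ t ∈ Icc 1 T, 0 ≤ ∑ x ∈ Icc 1 M, A x t * val k C f A x t := fun t ht =>
    sum_nonneg fun x hx => mul_nonneg (hA.1 x t) (hv x hx t ht)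
  set U := util M T k C f A A with hU
  have hU0 : 0 ≤ U := sum_nonneg hcol
  have hδ : 0 < 1 - δ := by linarith
  have hround : ∀ t ∈ Icc 1 (min T M),
      ∑ x ∈ Icc 1 M, A x t * (val k C f A x t - m t) + m t
        ≤ (∑ x ∈ Icc 1 M, A x t * val k C f A x t) / (1 - δ) := fun t ht => by
    have h1 : (∑ x ∈ Icc 1 M, A x t) * m t ≤ ∑ x ∈ Icc 1 M, A x t * val k C f A x t := by
      rw [sum_mul]
      refine sum_le_sum fun x hx => ?_
      rcases (hA.1 x t).eq_or_lt with h | h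
      · simp [← h]
      · exact mul_le_mul_of_nonneg_left ((hm t ht).2.1 x hx h) h.le
    have h2 := mul_le_mul_of_nonneg_right (hDR t (mem_Icc.1 ht).1 (mem_Icc.1 ht).2) (hm t ht).1
    simp only [mul_sub, sum_sub_distrib, ← sum_mul]
    rw [le_div_iff₀ hδ]
    nlinarith
  have hrounds : ∑ t ∈ Icc 1 (min T M),
      (∑ x ∈ Icc 1 M, A x t * (val k C f A x t - m t) + m t) ≤ U / (1 - δ) := by
    refine (sum_le_sum hround).trans ?_
    rw [← sum_div]
    gcongr
    exact sum_le_sum_of_subset_of_nonneg hsub fun t ht _ => hcol t ht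
  have hαsum : ∑ x ∈ Icc 1 M, α x ≤ C k * U
      + ∑ t ∈ Icc 1 (min T M), ∑ x ∈ Icc 1 M, A x t * (val k C f A x t - m t) := by
    refine (sum_le_sum fun x hx => (hα x hx).2.2).trans (le_of_eq ?_)
    rw [sum_add_distrib, ← mul_sum, hU, util, sum_comm, sum_comm (s := Icc 1 M)]
  have hβsum : ∑ t ∈ Icc 1 (min T M), (m t + ε) ≤ ∑ t ∈ Icc 1 (min T M), m t + T * ε := by
    rw [sum_add_distrib, sum_const, Nat.card_Icc, nsmul_eq_mul, Nat.add_sub_cancel]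
    gcongr
    exact min_le_left T M
  rw [sum_add_distrib] at hrounds
  have hCU : C k * U ≤ C k * U / (1 - δ) :=
    le_div_self (mul_nonneg (hC.1 k (by omega) le_rfl) hU0) hδ (by linarith)
  have hsplit : (1 + C k) / (1 - δ) * U = U / (1 - δ) + C k * U / (1 - δ) := by ring
  rw [hsplit]
  linarith
end

section
/- For any congestion policy C, if a profile P of k strategies is at equilibrium and success(P) < 1, then every strategy A ∈ P is non-redundant. -/
open Finset

noncomputable instance : DecidableEq (ℕ → ℕ → ℝ) := Classical.decEq _

/-- The value of box `x` at round `t` against the profile `P` (a multiset of strategies):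
`v_P(x,t) = f(x)·Σ_ℓ C(ℓ+1)·Σ_{I ⊆ P, |I| = ℓ} Π_{A∈I} A(x,t) · Π_{A∈P∖I} N̄_A(x,t)`. -/
noncomputable def pVal (C f : ℕ → ℝ) (P : Multiset (ℕ → ℕ → ℝ)) (x t : ℕ) : ℝ :=
  f x * ∑ ℓ ∈ range (Multiset.card P + 1), C (ℓ + 1) *
    ((P.powersetCard ℓ).map fun I =>
      (I.map fun A => A x t).prod * ((P - I).map fun A => Nbar A x t).prod).sum

/-- The utility of `B` against the profile `P`. -/
noncomputable def pUtil (M T : ℕ) (C f : ℕ → ℝ) (P : Multiset (ℕ → ℕ → ℝ)) (B : ℕ → ℕ → ℝ) : ℝ :=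
  ∑ t ∈ Icc 1 T, ∑ x ∈ Icc 1 M, B x t * pVal C f P x t

/-- The success probability of the profile `P`. -/
def success (M T : ℕ) (f : ℕ → ℝ) (P : Multiset (ℕ → ℕ → ℝ)) : ℝ :=
  ∑ x ∈ Icc 1 M, f x * (1 - (P.map fun A => Nbar A x T).prod)

lemma Substochastic.Nbar_le {M T : ℕ} {A : ℕ → ℕ → ℝ} (hA : Substochastic M T A) {x t : ℕ}
    (ht : t ≤ T) : Nbar A x T ≤ Nbar A x t :=
  sub_le_sub_left (sum_le_sum_of_subset_of_nonneg (Icc_subset_Icc_right ht)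
    fun s _ _ => hA.1 x s) 1

/-- If the success probability is less than 1, some box may be left unvisited by all players. -/
lemma exists_forall_Nbar_pos {M T : ℕ} {f : ℕ → ℝ} (hf : BoxDist M f)
    {P : Multiset (ℕ → ℕ → ℝ)} (hsub : ∀ A ∈ P, Substochastic M T A)
    (hsucc : success M T f P < 1) :
    ∃ x ∈ Icc 1 M, ∀ A ∈ P, 0 < Nbar A x T := by
  obtain ⟨x, hx, hlt⟩ : ∃ x ∈ Icc 1 M, f x * (1 - (P.map fun A => Nbar A x T).prod) < f x :=
    exists_lt_of_sum_lt (hsucc.trans_eq hf.2.2.symm)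
  refine ⟨x, hx, fun A hA => ((hsub A hA).Nbar_nonneg hx le_rfl).lt_of_ne' fun h0 => ?_⟩
  have h : (P.map fun A => Nbar A x T).prod = 0 :=
    Multiset.prod_eq_zero (Multiset.mem_map.2 ⟨A, hA, h0⟩)
  simp [h] at hlt

/-- A box that nobody in the profile has visited for certain has positive value. -/
lemma pVal_pos {M T k : ℕ} {C f : ℕ → ℝ} (hC : Policy k C) {P : Multiset (ℕ → ℕ → ℝ)}
    (hcard : Multiset.card P + 1 ≤ k) (hsub : ∀ A ∈ P, Substochastic M T A) {x t : ℕ}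
    (hfx : 0 < f x) (ht : t ≤ T) (hpos : ∀ A ∈ P, 0 < Nbar A x T) : 0 < pVal C f P x t := by
  have hN : ∀ A ∈ P, 0 < Nbar A x t := fun A hA => (hpos A hA).trans_le ((hsub A hA).Nbar_le ht)
  refine mul_pos hfx (sum_pos' (fun ℓ hℓ => ?_) ⟨0, by simp, ?_⟩)
  · refine mul_nonneg (hC.1 _ (by omega) (by have := mem_range.1 hℓ; omega))
      (Multiset.sum_nonneg fun y hy => ?_)
    obtain ⟨I, hI, rfl⟩ := Multiset.mem_map.1 hy
    refine mul_nonneg (Multiset.prod_nonneg fun z hz => ?_) (Multiset.prod_nonneg fun z hz => ?_)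
    · obtain ⟨A, hA, rfl⟩ := Multiset.mem_map.1 hz
      exact (hsub A (Multiset.mem_of_le (Multiset.mem_powersetCard.1 hI).1 hA)).1 x t
    · obtain ⟨A, hA, rfl⟩ := Multiset.mem_map.1 hz
      exact (hN A (Multiset.mem_of_le (Multiset.sub_le_self P I) hA)).le
  · have h : 0 < (P.map fun A => Nbar A x t).prod := Multiset.prod_pos fun z hz => by
      obtain ⟨A, hA, rfl⟩ := Multiset.mem_map.1 hz
      exact hN A hA
    simpa [hC.2.1] using h

/-- The matrix `A` with `ε` added to the entry `(x, t)`. -/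
def bump (A : ℕ → ℕ → ℝ) (x t : ℕ) (ε : ℝ) (y s : ℕ) : ℝ :=
  A y s + if y = x ∧ s = t then ε else 0

lemma Substochastic.bump {M T : ℕ} {A : ℕ → ℕ → ℝ} (hA : Substochastic M T A) {x t : ℕ} {ε : ℝ}
    (hε : 0 ≤ ε) (hrow : ε ≤ Nbar A x T) (hcol : ε ≤ 1 - ∑ y ∈ Icc 1 M, A y t) :
    Substochastic M T (bump A x t ε) := by
  refine ⟨fun y s => add_nonneg (hA.1 y s) (by split_ifs <;> simp [hε]), fun y hy => ?_,
    fun s hs => ?_⟩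
  · have h := hA.2.1 y hy
    by_cases hyx : y = x
    · subst hyx
      simp only [_root_.bump, sum_add_distrib, true_and, sum_ite_eq']
      unfold Nbar at hrow
      split_ifs <;> linarith
    · simpa [_root_.bump, hyx] using h
  · have h := hA.2.2 s hs
    by_cases hst : s = t
    · subst hst
      simp only [_root_.bump, sum_add_distrib, and_true, sum_ite_eq']
      split_ifs <;> linarith
    · simpa [_root_.bump, hst] using h

lemma pUtil_bump {M T : ℕ} (C f : ℕ → ℝ) (P : Multiset (ℕ → ℕ → ℝ)) (A : ℕ → ℕ → ℝ) {x t : ℕ}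
    (hx : x ∈ Icc 1 M) (ht : t ∈ Icc 1 T) (ε : ℝ) :
    pUtil M T C f P (bump A x t ε) = pUtil M T C f P A + ε * pVal C f P x t := by
  simp only [pUtil, bump, add_mul, sum_add_distrib, ite_and, ite_mul, zero_mul, sum_ite_eq',
    hx, ht, if_true]

/-- for any congestion policy, in an equilibrium profile of `k` strategies
whose success probability is less than 1, every player is non-redundant. -/
theorem equilibrium_players_non_redundant
    (M T k : ℕ) (hM : 1 ≤ M) (hT : 1 ≤ T) (hk : 2 ≤ k)
    (C f : ℕ → ℝ) (hC : Policy k C) (hf : BoxDist M f)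
    (P : Multiset (ℕ → ℕ → ℝ)) (hcard : Multiset.card P = k)
    (hsub : ∀ A ∈ P, Substochastic M T A)
    (hnash : ∀ A ∈ P, ∀ B, Substochastic M T B →
      pUtil M T C f (P.erase A) B ≤ pUtil M T C f (P.erase A) A)
    (hsucc : success M T f P < 1) :
    ∀ A ∈ P, NonRedundant M T A := by
  intro A hA t ht1 ht
  have htT : t ≤ T := ht.trans (min_le_left _ _)
  have ht' : t ∈ Icc 1 T := mem_Icc.2 ⟨ht1, htT⟩
  obtain ⟨x, hx, hpos⟩ := exists_forall_Nbar_pos hf hsub hsucc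
  by_contra hne
  have hlt : 0 < 1 - ∑ y ∈ Icc 1 M, A y t :=
    sub_pos.2 (lt_of_le_of_ne ((hsub A hA).2.2 t ht') hne)
  have hε := lt_min (hpos A hA) hlt
  have herase : ∀ B ∈ P.erase A, B ∈ P := fun B hB => Multiset.mem_of_mem_erase hB
  have hval : 0 < pVal C f (P.erase A) x t :=
    pVal_pos hC (by rw [Multiset.card_erase_add_one hA, hcard])
      (fun B hB => hsub B (herase B hB)) (hf.1 x hx) htT fun B hB => hpos B (herase B hB)
  have h := hnash A hA _ ((hsub A hA).bump hε.le (min_le_left _ _) (min_le_right _ _))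
  rw [pUtil_bump C f _ A hx ht'] at h
  linarith [mul_pos hε hval]
end

section
/- Let C be any congestion policy and let A, B be doubly-substochastic M×T matrices, x a box, and t ≤ T a round. If A(x,t) > B(x,t) and A(x,s) = B(x,s) for every s < t, then v_A(x,t) < v_B(x,t). -/
open Finset

/-- The homogeneous Bernstein form of degree `n` with coefficients `c`. -/
def bernsteinForm (n : ℕ) (c : ℕ → ℝ) (p r : ℝ) : ℝ :=
  ∑ ℓ ∈ range (n + 1), c ℓ * (n.choose ℓ : ℝ) * p ^ ℓ * r ^ (n - ℓ)

lemma bernsteinForm_zero (c : ℕ → ℝ) (p r : ℝ) : bernsteinForm 0 c p r = c 0 := by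
  simp [bernsteinForm]

lemma bernsteinForm_succ (n : ℕ) (c : ℕ → ℝ) (p r : ℝ) :
    bernsteinForm (n + 1) c p r =
      r * bernsteinForm n c p r + p * bernsteinForm n (fun ℓ => c (ℓ + 1)) p r := by
  have h := Finset.sum_choose_succ_mul (fun i j => c i * p ^ i * r ^ j) n
  calc bernsteinForm (n + 1) c p r
      = ∑ i ∈ range (n + 2), ((n + 1).choose i : ℝ) * (c i * p ^ i * r ^ (n + 1 - i)) :=
        Finset.sum_congr rfl fun i _ => by ring
    _ = _ := by
      rw [h, bernsteinForm, bernsteinForm, Finset.mul_sum, Finset.mul_sum]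
      congr 1 <;> refine Finset.sum_congr rfl fun i hi => ?_
      · rw [Nat.succ_sub (Nat.lt_succ_iff.mp (Finset.mem_range.mp hi)), pow_succ]
        ring
      · ring

lemma bernsteinForm_mono {n : ℕ} {c d : ℕ → ℝ} {p r : ℝ} (hp : 0 ≤ p) (hr : 0 ≤ r)
    (h : ∀ ℓ ≤ n, c ℓ ≤ d ℓ) : bernsteinForm n c p r ≤ bernsteinForm n d p r := by
  refine Finset.sum_le_sum fun ℓ hℓ => ?_
  have := h ℓ (Nat.lt_succ_iff.mp (Finset.mem_range.mp hℓ))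
  gcongr

lemma bernsteinForm_lt {n : ℕ} {c d : ℕ → ℝ} {p r : ℝ} (hp : 0 ≤ p) (hr : 0 < r)
    (h : ∀ ℓ ≤ n, c ℓ ≤ d ℓ) (h0 : c 0 < d 0) :
    bernsteinForm n c p r < bernsteinForm n d p r := by
  refine Finset.sum_lt_sum (fun ℓ hℓ => ?_) ⟨0, by simp, ?_⟩
  · have := h ℓ (Nat.lt_succ_iff.mp (Finset.mem_range.mp hℓ))
    gcongr
  · simpa using mul_lt_mul_of_pos_right h0 (pow_pos hr n)

/-- Moving mass from the second variable to the first decreases a Bernstein form with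
nonincreasing coefficients. -/
lemma bernsteinForm_antitone {n : ℕ} {c : ℕ → ℝ} {q p p' : ℝ} (hp' : 0 ≤ p') (hlt : p' < p)
    (hpq : p ≤ q) (hc : ∀ ℓ < n, c (ℓ + 1) ≤ c ℓ) :
    bernsteinForm n c p (q - p) ≤ bernsteinForm n c p' (q - p') := by
  induction n generalizing c with
  | zero => simp [bernsteinForm_zero]
  | succ n ih =>
    have h1 := ih (c := c) fun ℓ hℓ => hc ℓ (by omega)
    have h2 := ih (c := fun ℓ => c (ℓ + 1)) fun ℓ hℓ => hc (ℓ + 1) (by omega)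
    have h3 := bernsteinForm_mono (n := n) (c := fun ℓ => c (ℓ + 1)) (d := c) hp'
      (show 0 ≤ q - p' by linarith) fun ℓ hℓ => hc ℓ (by omega)
    rw [bernsteinForm_succ, bernsteinForm_succ]
    nlinarith [mul_le_mul_of_nonneg_left h1 (sub_nonneg.mpr hpq),
      mul_le_mul_of_nonneg_left h2 (hp'.trans hlt.le),
      mul_le_mul_of_nonneg_left h3 (sub_pos.mpr hlt).le]

/-- Moving mass from the second variable to the first strictly decreases a Bernstein form with
nonincreasing, nonconstant coefficients. -/
lemma bernsteinForm_strictAnti {n : ℕ} {c : ℕ → ℝ} {q p p' : ℝ} (hp' : 0 ≤ p') (hlt : p' < p)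
    (hpq : p ≤ q) (hc : ∀ ℓ < n, c (ℓ + 1) ≤ c ℓ) (hs : ∃ ℓ < n, c (ℓ + 1) < c ℓ) :
    bernsteinForm n c p (q - p) < bernsteinForm n c p' (q - p') := by
  induction n generalizing c with
  | zero => obtain ⟨ℓ, hℓ, -⟩ := hs; omega
  | succ n ih =>
    have hle1 := bernsteinForm_antitone (n := n) hp' hlt hpq fun ℓ hℓ => hc ℓ (by omega)
    have hc' : ∀ ℓ < n, c (ℓ + 1 + 1) ≤ c (ℓ + 1) := fun ℓ hℓ => hc (ℓ + 1) (by omega)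
    have hcd : ∀ ℓ ≤ n, c (ℓ + 1) ≤ c ℓ := fun ℓ hℓ => hc ℓ (by omega)
    have hr' : 0 < q - p' := by linarith
    rw [bernsteinForm_succ, bernsteinForm_succ]
    have h1 := mul_le_mul_of_nonneg_left hle1 (sub_nonneg.mpr hpq)
    obtain ⟨ℓ, hℓ, hd⟩ := hs
    cases ℓ with
    | zero =>
      have h2 := mul_le_mul_of_nonneg_left
        (bernsteinForm_antitone (c := fun ℓ => c (ℓ + 1)) hp' hlt hpq hc') (hp'.trans hlt.le)
      have h3 := mul_lt_mul_of_pos_left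
        (bernsteinForm_lt (c := fun ℓ => c (ℓ + 1)) hp' hr' hcd hd) (sub_pos.mpr hlt)
      nlinarith
    | succ m =>
      have h2 := mul_lt_mul_of_pos_left
        (ih (c := fun ℓ => c (ℓ + 1)) hc' ⟨m, by omega, hd⟩) (hp'.trans_lt hlt)
      have h3 := mul_le_mul_of_nonneg_left
        (bernsteinForm_mono (c := fun ℓ => c (ℓ + 1)) hp' hr'.le hcd) (sub_pos.mpr hlt).le
      nlinarith

lemma Policy.exists_lt_succ {k : ℕ} {C : ℕ → ℝ} (hC : Policy k C) :
    ∃ ℓ < k - 1, C (ℓ + 1 + 1) < C (ℓ + 1) := by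
  obtain ⟨-, h1, -, m, hm1, hmk, hm⟩ := hC
  by_contra! hcon
  have hge : ∀ j, j < k → 1 ≤ C (j + 1) := by
    intro j
    induction j with
    | zero => intro _; simp [h1]
    | succ j ih => intro hj; exact (ih (by omega)).trans (hcon j (by omega))
  have := hge (m - 1) (by omega)
  rw [Nat.sub_add_cancel hm1] at this
  linarith

lemma Nbar_eq_sub {A : ℕ → ℕ → ℝ} {x t : ℕ} (ht : 1 ≤ t) :
    Nbar A x t = (1 - ∑ s ∈ Ico 1 t, A x s) - A x t := by
  rw [Nbar, ← Finset.sum_Ico_add_eq_sum_Icc ht]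
  ring

lemma val_eq_bernsteinForm {k : ℕ} (hk : 1 ≤ k) (C f : ℕ → ℝ) (A : ℕ → ℕ → ℝ) (x t : ℕ) :
    val k C f A x t =
      f x * bernsteinForm (k - 1) (fun ℓ => C (ℓ + 1)) (A x t) (Nbar A x t) := by
  rw [_root_.val, bernsteinForm, Nat.sub_add_cancel hk]

/-- monotonicity of the value in the visiting probability. If `A` and `B`
agree at `(x, s)` for all `s < t` and `A(x,t) > B(x,t)`, then `v_A(x,t) < v_B(x,t)`. -/
theorem value_strict_antitone_in_probability
    (M T k : ℕ) (hM : 1 ≤ M) (hT : 1 ≤ T) (hk : 2 ≤ k)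
    (C f : ℕ → ℝ) (hC : Policy k C) (hf : BoxDist M f)
    (A B : ℕ → ℕ → ℝ) (hA : Substochastic M T A) (hB : Substochastic M T B)
    (x t : ℕ) (hx : x ∈ Icc 1 M) (ht : t ∈ Icc 1 T)
    (hgt : B x t < A x t) (hagree : ∀ s, s < t → A x s = B x s) :
    val k C f A x t < val k C f B x t := by
  obtain ⟨ht1, htT⟩ := Finset.mem_Icc.mp ht
  have hN := hA.Nbar_nonneg hx htT
  have hq : ∑ s ∈ Ico 1 t, A x s = ∑ s ∈ Ico 1 t, B x s :=
    Finset.sum_congr rfl fun s hs => hagree s (Finset.mem_Ico.mp hs).2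
  rw [Nbar_eq_sub ht1] at hN
  rw [val_eq_bernsteinForm (by omega), val_eq_bernsteinForm (by omega), Nbar_eq_sub ht1,
    Nbar_eq_sub ht1, ← hq]
  exact mul_lt_mul_of_pos_left
    (bernsteinForm_strictAnti (hB.1 x t) hgt (sub_nonneg.mp hN)
      (fun ℓ hℓ => hC.2.2.1 _ _ (by omega) (by omega) (by omega)) hC.exists_lt_succ)
    (hf.1 x hx)
end

section
/- Let k ≥ 2 and let C : {1,…,k} → [0,∞) be nonincreasing with C(1) = 1 and C(ℓ) < 1 for some ℓ ≤ k. Then the function Ψ(p) = Σ_{ℓ=0}^{k−1} C(ℓ+1)·binom(k−1,ℓ)·p^ℓ·(1−p)^{k−1−ℓ} is strictly decreasing on [0,1]: for all 0 ≤ p < p′ ≤ 1, Ψ(p′) < Ψ(p). -/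
open Finset

/-- The Bernstein polynomial of degree `n` with coefficients `f`, evaluated at `p`. -/
noncomputable def bernsteinSum (n : ℕ) (f : ℕ → ℝ) (p : ℝ) : ℝ :=
  ∑ l ∈ range (n + 1), f l * (n.choose l : ℝ) * p ^ l * (1 - p) ^ (n - l)

theorem bernsteinSum_succ (n : ℕ) (f : ℕ → ℝ) (p : ℝ) :
    bernsteinSum (n + 1) f p =
      (1 - p) * bernsteinSum n f p + p * bernsteinSum n (fun i => f (i + 1)) p := by
  have h : (1 - p) * bernsteinSum n f p =
      ∑ l ∈ range (n + 2), f l * (n.choose l : ℝ) * p ^ l * (1 - p) ^ (n + 1 - l) := by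
    rw [sum_range_succ, Nat.choose_succ_self, bernsteinSum, mul_sum]
    simp only [Nat.cast_zero, mul_zero, zero_mul, add_zero]
    refine sum_congr rfl fun l hl => ?_
    rw [Nat.succ_sub (mem_range_succ_iff.mp hl), pow_succ]
    ring
  rw [h, bernsteinSum, bernsteinSum, sum_range_succ', sum_range_succ' _ (n + 1), mul_sum,
    add_right_comm, ← sum_add_distrib]
  simp only [Nat.choose_zero_right]
  congr 1
  refine sum_congr rfl fun l _ => ?_
  rw [Nat.choose_succ_succ, Nat.add_sub_add_right]
  push_cast
  ring

theorem bernsteinSum_mono {n : ℕ} {f g : ℕ → ℝ} (hfg : ∀ i ≤ n, f i ≤ g i) {p : ℝ}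
    (hp0 : 0 ≤ p) (hp1 : p ≤ 1) : bernsteinSum n f p ≤ bernsteinSum n g p := by
  have hq : 0 ≤ 1 - p := sub_nonneg.mpr hp1
  refine sum_le_sum fun l hl => ?_
  have := hfg l (mem_range_succ_iff.mp hl)
  gcongr

theorem bernsteinSum_lt_of_last_lt {n : ℕ} {f g : ℕ → ℝ} (hfg : ∀ i ≤ n, f i ≤ g i)
    (hlt : f n < g n) {p : ℝ} (hp0 : 0 < p) (hp1 : p ≤ 1) :
    bernsteinSum n f p < bernsteinSum n g p := by
  have hq : 0 ≤ 1 - p := sub_nonneg.mpr hp1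
  refine sum_lt_sum (fun l hl => ?_) ⟨n, self_mem_range_succ n, ?_⟩
  · have := hfg l (mem_range_succ_iff.mp hl)
    gcongr
  · simpa using mul_lt_mul_of_pos_right hlt (pow_pos hp0 n)

theorem bernsteinSum_antitone {n : ℕ} {f : ℕ → ℝ} (hf : ∀ i < n, f (i + 1) ≤ f i) {p p' : ℝ}
    (hp0 : 0 ≤ p) (hpp : p ≤ p') (hp1 : p' ≤ 1) : bernsteinSum n f p' ≤ bernsteinSum n f p := by
  induction n generalizing f with
  | zero => simp [bernsteinSum]
  | succ n ih =>
    have h₁ := ih fun i hi => hf i (by omega)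
    have h₂ := ih (f := fun i => f (i + 1)) fun i hi => hf (i + 1) (by omega)
    have h₃ := bernsteinSum_mono (n := n) (fun i hi => hf i (by omega)) (hp0.trans hpp) hp1
    rw [bernsteinSum_succ, bernsteinSum_succ]
    linarith [mul_le_mul_of_nonneg_left h₁ (sub_nonneg.mpr (hpp.trans hp1)),
      mul_le_mul_of_nonneg_left h₂ hp0, mul_le_mul_of_nonneg_left h₃ (sub_nonneg.mpr hpp)]

theorem bernsteinSum_strictAnti {n : ℕ} {f : ℕ → ℝ} (hf : ∀ i < n, f (i + 1) ≤ f i)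
    (hlt : f n < f 0) {p p' : ℝ} (hp0 : 0 ≤ p) (hpp : p < p') (hp1 : p' ≤ 1) :
    bernsteinSum n f p' < bernsteinSum n f p := by
  induction n with
  | zero => exact absurd hlt (lt_irrefl _)
  | succ n ih =>
    have hf' : ∀ i < n, f (i + 1) ≤ f i := fun i hi => hf i (by omega)
    have hstep : ∀ i ≤ n, f (i + 1) ≤ f i := fun i hi => hf i (by omega)
    have h₂ := bernsteinSum_antitone (n := n) (f := fun i => f (i + 1))
      (fun i hi => hf (i + 1) (by omega)) hp0 hpp.le hp1
    have hp' : 0 < p' := hp0.trans_lt hpp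
    have hq : 0 < 1 - p := sub_pos.mpr (hpp.trans_le hp1)
    rw [bernsteinSum_succ, bernsteinSum_succ]
    rcases lt_or_ge (f n) (f 0) with hn | hn
    · have h₁ := ih hf' hn
      have h₃ := bernsteinSum_mono hstep hp'.le hp1
      linarith [mul_lt_mul_of_pos_left h₁ hq, mul_le_mul_of_nonneg_left h₂ hp0,
        mul_le_mul_of_nonneg_left h₃ (sub_nonneg.mpr hpp.le)]
    · have h₁ := bernsteinSum_antitone hf' hp0 hpp.le hp1
      have h₃ := bernsteinSum_lt_of_last_lt hstep (hlt.trans_le hn) hp' hp1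
      linarith [mul_le_mul_of_nonneg_left h₁ hq.le, mul_le_mul_of_nonneg_left h₂ hp0,
        mul_lt_mul_of_pos_left h₃ (sub_pos.mpr hpp)]

/-- for a congestion policy `C` (nonnegative, nonincreasing on `1..k`,
`C 1 = 1`, `C ℓ < 1` for some `ℓ ≤ k`), the expected reward
`Ψ(p) = Σ_{ℓ=0}^{k-1} C(ℓ+1)·binom(k-1,ℓ)·p^ℓ·(1-p)^{k-1-ℓ}` is strictly decreasing
on `[0,1]`. -/
theorem Psi_strict_anti
    (k : ℕ) (hk : 2 ≤ k) (C : ℕ → ℝ)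
    (hnn : ∀ ℓ, 1 ≤ ℓ → ℓ ≤ k → 0 ≤ C ℓ) (h1 : C 1 = 1)
    (hmono : ∀ ℓ ℓ', 1 ≤ ℓ → ℓ ≤ ℓ' → ℓ' ≤ k → C ℓ' ≤ C ℓ)
    (hlt : ∃ ℓ, 1 ≤ ℓ ∧ ℓ ≤ k ∧ C ℓ < 1)
    (p p' : ℝ) (hp0 : 0 ≤ p) (hpp : p < p') (hp1 : p' ≤ 1) :
    (∑ ℓ ∈ range k, C (ℓ + 1) * ((k - 1).choose ℓ : ℝ) * p' ^ ℓ * (1 - p') ^ (k - 1 - ℓ)) <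
    (∑ ℓ ∈ range k, C (ℓ + 1) * ((k - 1).choose ℓ : ℝ) * p ^ ℓ * (1 - p) ^ (k - 1 - ℓ)) := by
  obtain ⟨l, hl1, hlk, hl⟩ := hlt
  obtain ⟨n, rfl⟩ : ∃ n, k = n + 1 := ⟨k - 1, by omega⟩
  refine bernsteinSum_strictAnti (f := fun i => C (i + 1))
    (fun i hi => hmono _ _ (by omega) (by omega) (by omega)) ?_ hp0 hpp hp1
  simpa [h1] using (hmono l (n + 1) hl1 hlk le_rfl).trans_lt hl
end

section
/- For integers n ≥ 1 and 1 ≤ i ≤ n, and reals p ≥ 0 and ε ≥ 0 with p + ε ≤ 1, one has X^n_i(p+ε) − X^n_i(p) ≥ ε^n, where X^n_i(r) = Σ_{j=i}^{n} binom(n,j)·r^j·(1−r)^{n−j} is the probability that at least i out of n independent Bernoulli(r) random variables equal 1. -/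
open Finset

/-- The probability that at least `i` of `n` independent Bernoulli(`r`) variables equal `1`. -/
def binomialTail (n i : ℕ) (r : ℝ) : ℝ :=
  ∑ j ∈ Icc i n, (n.choose j : ℝ) * r ^ j * (1 - r) ^ (n - j)

namespace binomialTail

theorem zero_right (n : ℕ) (r : ℝ) : binomialTail n 0 r = 1 := by
  have h := add_pow r (1 - r) n
  rw [add_sub_cancel, one_pow, Nat.range_succ_eq_Icc_zero] at h
  rw [h, binomialTail]
  exact sum_congr rfl fun j _ => by ring

theorem eq_zero_of_lt {n i : ℕ} (h : n < i) (r : ℝ) : binomialTail n i r = 0 := by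
  rw [binomialTail, Icc_eq_empty (by lia), sum_empty]

theorem eq_add_succ {n i : ℕ} (h : i ≤ n) (r : ℝ) :
    binomialTail n i r =
      (n.choose i : ℝ) * r ^ i * (1 - r) ^ (n - i) + binomialTail n (i + 1) r := by
  rw [binomialTail, binomialTail, ← Finset.insert_Icc_add_one_left_eq_Icc h,
    sum_insert (by simp)]

theorem succ_le {r : ℝ} (h0 : 0 ≤ r) (h1 : r ≤ 1) (n i : ℕ) :
    binomialTail n (i + 1) r ≤ binomialTail n i r := by
  rcases le_or_gt i n with h | h
  · rw [eq_add_succ h]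
    have : 0 ≤ 1 - r := by linarith
    exact le_add_of_nonneg_left (by positivity)
  · rw [eq_zero_of_lt h, eq_zero_of_lt (by lia)]

theorem one_right (n : ℕ) (r : ℝ) : binomialTail n 1 r = 1 - (1 - r) ^ n := by
  have h := eq_add_succ n.zero_le r
  rw [zero_right] at h
  simp at h
  linarith

/-- Conditioning on the outcome of one trial. -/
theorem succ_succ (n i : ℕ) (r : ℝ) :
    binomialTail (n + 1) (i + 1) r =
      r * binomialTail n i r + (1 - r) * binomialTail n (i + 1) r := by
  rcases le_or_gt i n with h | h
  · have shift (f : ℕ → ℝ) : ∑ j ∈ Icc (i + 1) (n + 1), f j = ∑ j ∈ Icc i n, f (j + 1) := by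
      rw [← Finset.map_add_right_Icc i n 1, sum_map]
      rfl
    have drop : (1 - r) * binomialTail n (i + 1) r =
        ∑ j ∈ Icc (i + 1) (n + 1), (n.choose j : ℝ) * r ^ j * (1 - r) ^ (n + 1 - j) := by
      rw [sum_Icc_succ_top (by lia), Nat.choose_succ_self, binomialTail, mul_sum]
      simp only [Nat.cast_zero, zero_mul, add_zero]
      refine sum_congr rfl fun j hj => ?_
      rw [Nat.succ_sub (mem_Icc.1 hj).2, pow_succ]
      ring
    rw [drop, shift, binomialTail, shift, binomialTail, mul_sum, ← sum_add_distrib]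
    refine sum_congr rfl fun j _ => ?_
    rw [Nat.choose_succ_succ, Nat.add_sub_add_right]
    push_cast
    ring
  · simp [eq_zero_of_lt, h, Nat.lt_succ_of_lt h]

theorem succ_succ_sub_succ_succ (n i : ℕ) (p ε : ℝ) :
    binomialTail (n + 1) (i + 1) (p + ε) - binomialTail (n + 1) (i + 1) p =
      p * (binomialTail n i (p + ε) - binomialTail n i p) +
      (1 - (p + ε)) * (binomialTail n (i + 1) (p + ε) - binomialTail n (i + 1) p) +
      ε * (binomialTail n i (p + ε) - binomialTail n (i + 1) p) := by
  rw [succ_succ, succ_succ]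
  ring

variable {p ε : ℝ}

theorem le_add (hp : 0 ≤ p) (hε : 0 ≤ ε) (hpε : p + ε ≤ 1) (n i : ℕ) :
    binomialTail n i p ≤ binomialTail n i (p + ε) := by
  induction n generalizing i with
  | zero =>
    cases i with
    | zero => simp [zero_right]
    | succ i => simp [eq_zero_of_lt]
  | succ n ih =>
    cases i with
    | zero => simp [zero_right]
    | succ i =>
      rw [← sub_nonneg, succ_succ_sub_succ_succ]
      have h₀ := sub_nonneg.2 (ih i)
      have h₁ := sub_nonneg.2 (ih (i + 1))
      have h₂ := sub_nonneg.2 ((succ_le hp (by linarith) n i).trans (ih i))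
      have hq := sub_nonneg.2 hpε
      positivity

theorem pow_le_sub (hp : 0 ≤ p) (hε : 0 ≤ ε) (hpε : p + ε ≤ 1) {n i : ℕ} (h : i < n) :
    ε ^ n ≤ binomialTail n (i + 1) (p + ε) - binomialTail n (i + 1) p := by
  induction n generalizing i with
  | zero => lia
  | succ n ih =>
    have key : ε ^ n ≤ binomialTail n i (p + ε) - binomialTail n (i + 1) p := by
      cases i with
      | zero =>
        rw [zero_right, one_right, sub_sub_cancel]
        exact pow_le_pow_left₀ hε (by linarith) n
      | succ i =>
        have := ih (i := i) (by lia)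
        linarith [succ_le hp (by linarith) n (i + 1)]
    rw [succ_succ_sub_succ_succ, pow_succ']
    have h₀ := mul_nonneg hp (sub_nonneg.2 (le_add hp hε hpε n i))
    have h₁ := mul_nonneg (sub_nonneg.2 hpε) (sub_nonneg.2 (le_add hp hε hpε n (i + 1)))
    linarith [mul_le_mul_of_nonneg_left key hε]

end binomialTail

/-- for `1 ≤ i ≤ n` and `0 ≤ p`, `0 ≤ ε` with `p + ε ≤ 1`,
`X^n_i(p+ε) - X^n_i(p) ≥ ε^n`, where `X^n_i(r) = Σ_{j=i}^n binom(n,j)·r^j·(1-r)^{n-j}`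
is the probability that at least `i` of `n` independent Bernoulli(`r`) variables equal 1. -/
theorem binomial_tail_increment
    (n i : ℕ) (hn : 1 ≤ n) (hi1 : 1 ≤ i) (hin : i ≤ n)
    (p ε : ℝ) (hp : 0 ≤ p) (hε : 0 ≤ ε) (hpε : p + ε ≤ 1) :
    ε ^ n ≤
      (∑ j ∈ Icc i n, (n.choose j : ℝ) * (p + ε) ^ j * (1 - (p + ε)) ^ (n - j)) -
      (∑ j ∈ Icc i n, (n.choose j : ℝ) * p ^ j * (1 - p) ^ (n - j)) := by
  obtain ⟨k, rfl⟩ := Nat.exists_eq_add_of_le' hi1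
  exact binomialTail.pow_le_sub hp hε hpε hin
end
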